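/- Suppose a_s are complex numbers with Σ_s |a_s| < ∞, k_s ∈ {1,…,r} are positive integers, and z_s are distinct-as-pairs (k_s, z_s) complex numbers with Re z_s = 0 and δ ≤ |Im z_s| ≤ 1/δ for 0 < δ < 1. If Σ_s a_s/(x − z_s)^{k_s} = 0 for all real x, then a_s = 0 for all s. -/

import Mathlib

open Filter Topology in
theorem aux_zero (r : ℕ) (a : ℕ → ℂ) (ha : Summable fun s => ‖a s‖)
    (k : ℕ → ℕ) (hk : ∀ s, 1 ≤ k s ∧ k s ≤ r)
    (z : ℕ → ℂ) (hre : ∀ s, (z s).re = 0)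
    (hsum : ∀ x : ℝ, ∑' s, a s / ((x : ℂ) - z s) ^ k s = 0)
    (w : ℂ) (hw : 0 < w.re) : ∑' s, a s / (w - z s) ^ k s = 0 := by
  obtain ⟨c, hc0, hcw⟩ : ∃ c : ℝ, 0 < c ∧ c < w.re := exists_between hw
  let U : Set ℂ := {v | c < v.re}
  have hU : IsOpen U := isOpen_lt continuous_const Complex.continuous_re
  have hconv : Convex ℝ U := convex_halfSpace_re_gt c
  have hlow : ∀ v ∈ U, ∀ s, c ≤ ‖v - z s‖ := by
    intro v hv s
    have h1 := Complex.re_le_norm (v - z s)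
    have h2 : c < v.re := hv
    simp only [Complex.sub_re, hre, sub_zero] at h1
    linarith
  have hne : ∀ v ∈ U, ∀ s, v - z s ≠ 0 := by
    intro v hv s h
    have := hlow v hv s
    rw [h, norm_zero] at this
    linarith
  have hd : DifferentiableOn ℂ (fun v => ∑' s, a s / (v - z s) ^ k s) U := by
    refine Complex.differentiableOn_tsum_of_summable_norm
      (u := fun s => ‖a s‖ * (max 1 c⁻¹) ^ r) (ha.mul_right _) ?_ hU ?_
    · intro s v hv
      refine DifferentiableAt.differentiableWithinAt ?_
      exact (differentiableAt_const _).div (by fun_prop) (pow_ne_zero _ (hne v hv s))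
    · intro s v hv
      rw [norm_div, norm_pow, div_eq_mul_inv, ← inv_pow]
      refine mul_le_mul_of_nonneg_left ?_ (norm_nonneg _)
      have h1 : ‖v - z s‖⁻¹ ≤ max 1 c⁻¹ :=
        (inv_anti₀ hc0 (hlow v hv s)).trans (le_max_right _ _)
      calc ‖v - z s‖⁻¹ ^ k s ≤ (max 1 c⁻¹) ^ k s := by gcongr
        _ ≤ (max 1 c⁻¹) ^ r := pow_le_pow_right₀ (le_max_left _ _) (hk s).2
  have han := hd.analyticOnNhd hU
  have hx0 : ((c + 1 : ℝ) : ℂ) ∈ U := by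
    change c < ((c + 1 : ℝ) : ℂ).re
    rw [Complex.ofReal_re]; linarith
  have hfreq : ∃ᶠ v in 𝓝[≠] ((c + 1 : ℝ) : ℂ), (∑' s, a s / (v - z s) ^ k s) = 0 := by
    have ht : Tendsto (fun x : ℝ => (x : ℂ)) (𝓝[≠] (c + 1)) (𝓝[≠] ((c + 1 : ℝ) : ℂ)) := by
      refine tendsto_nhdsWithin_of_tendsto_nhds_of_eventually_within _
        ((Complex.continuous_ofReal.tendsto _).mono_left nhdsWithin_le_nhds) ?_
      filter_upwards [self_mem_nhdsWithin] with x hx h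
      exact hx (Complex.ofReal_injective h)
    exact ht.frequently (Eventually.frequently (Eventually.of_forall hsum))
  exact han.eqOn_zero_of_preconnected_of_frequently_eq_zero hconv.isPreconnected hx0 hfreq hcw

open Filter Topology in
theorem stmt_6 (r : ℕ) (hr : 0 < r) (δ : ℝ) (hδ0 : 0 < δ) (hδ1 : δ < 1)
    (a : ℕ → ℂ) (ha : Summable fun s => ‖a s‖)
    (k : ℕ → ℕ) (hk : ∀ s, 1 ≤ k s ∧ k s ≤ r)
    (z : ℕ → ℂ) (hre : ∀ s, (z s).re = 0)
    (him : ∀ s, δ ≤ |(z s).im| ∧ |(z s).im| ≤ 1 / δ)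
    (hdist : Function.Injective fun s => (k s, z s))
    (hsum : ∀ x : ℝ, ∑' s, a s / ((x : ℂ) - z s) ^ k s = 0) :
    ∀ s, a s = 0 := by
  suffices H : ∀ n s, r < k s + n → a s = 0 by
    intro s
    exact H r s (by have := (hk s).1; omega)
  intro n
  induction n with
  | zero => intro s hs; have := (hk s).2; omega
  | succ n ih =>
  intro s0 hs0
  have hbig : ∀ s, k s0 < k s → a s = 0 := fun s hs => ih s (by omega)
  have hm : k s0 ≠ 0 := by have := (hk s0).1; omega
  have hlim : Tendsto (fun e : ℝ => ∑' s, (e : ℂ) ^ k s0 * (a s / ((z s0 + e) - z s) ^ k s))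
      (𝓝[>] 0) (𝓝 (∑' s, if s = s0 then a s0 else 0)) := by
    refine tendsto_tsum_of_dominated_convergence (bound := fun s => ‖a s‖) ha ?_ ?_
    · intro s
      by_cases hs : s = s0
      · subst hs
        simp only [if_true]
        refine tendsto_const_nhds.congr' ?_
        filter_upwards [self_mem_nhdsWithin] with e he
        have : (e : ℂ) ≠ 0 := Complex.ofReal_ne_zero.2 (ne_of_gt he)
        rw [add_sub_cancel_left]
        field_simp
      · simp only [if_neg hs]
        by_cases hkk : k s0 < k s
        · simp [hbig s hkk]
        by_cases hz : z s = z s0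
        · have hlt : k s < k s0 := by
            refine lt_of_le_of_ne (not_lt.1 hkk) fun h => hs (hdist ?_)
            simp [h, hz]
          have h1 : Tendsto (fun e : ℝ => (e : ℂ) ^ (k s0 - k s) * a s) (𝓝[>] 0) (𝓝 0) := by
            have : Continuous fun e : ℝ => (e : ℂ) ^ (k s0 - k s) * a s := by fun_prop
            have h2 := (this.tendsto 0).mono_left (nhdsWithin_le_nhds (s := Set.Ioi 0))
            simpa [(Nat.sub_pos_of_lt hlt).ne'] using h2
          refine h1.congr' ?_
          filter_upwards [self_mem_nhdsWithin] with e he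
          have he0 : (e : ℂ) ≠ 0 := Complex.ofReal_ne_zero.2 (ne_of_gt he)
          rw [hz, add_sub_cancel_left, pow_sub₀ _ he0 hlt.le]
          ring
        · have hc : ContinuousAt
              (fun e : ℝ => (e : ℂ) ^ k s0 * (a s / ((z s0 + e) - z s) ^ k s)) 0 := by
            refine ContinuousAt.mul (by fun_prop) (ContinuousAt.div (by fun_prop) (by fun_prop) ?_)
            refine pow_ne_zero _ ?_
            simpa [sub_eq_zero] using fun h => hz (Eq.symm h)
          have h2 := hc.tendsto.mono_left (nhdsWithin_le_nhds (s := Set.Ioi 0))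
          simpa [hm] using h2
    · filter_upwards [Ioo_mem_nhdsGT (zero_lt_one (α := ℝ))] with e he s
      by_cases hkk : k s0 < k s
      · simp [hbig s hkk]
      have hle := not_lt.1 hkk
      have hlow : e ≤ ‖z s0 + e - z s‖ := by
        have h1 := Complex.re_le_norm (z s0 + e - z s)
        simpa [hre] using h1
      have hpos : 0 < ‖z s0 + e - z s‖ := he.1.trans_le hlow
      rw [norm_mul, norm_div, norm_pow, norm_pow, Complex.norm_real, Real.norm_of_nonneg he.1.le,
        mul_div_left_comm]
      refine mul_le_of_le_one_right (norm_nonneg _) ?_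
      rw [div_le_one (by positivity)]
      exact (pow_le_pow_of_le_one he.1.le he.2.le hle).trans
        (pow_le_pow_left₀ he.1.le hlow _)
  have hzero : (fun e : ℝ => ∑' s, (e : ℂ) ^ k s0 * (a s / ((z s0 + e) - z s) ^ k s))
      =ᶠ[𝓝[>] 0] fun _ => 0 := by
    filter_upwards [self_mem_nhdsWithin] with e he
    rw [tsum_mul_left, aux_zero r a ha k hk z hre hsum _ (by simpa [hre] using he), mul_zero]
  rw [tsum_ite_eq] at hlim
  exact tendsto_nhds_unique hlim (tendsto_const_nhds.congr' hzero.symm)
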